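/- arXiv:1310.7453 — 5 statements merged into one kernel-verified Lean document; each statement's English description precedes it below -/
import Mathlib

section
/- Let k ≥ 1 and s, t ∈ ZMod k, set Dst := (t − s).val, and assume 0 < Dst ≤ ⌊k/2⌋ (so the positive arc from s to t is minimal). Let m := s + (⌊(Dst + k)/2⌋ : ZMod k) (the Wraparound Intermediate Destination coordinate with β = 1). Then d_k(s, m) + d_k(m, t) = k − Dst; i.e., routing through m forces the packet around the non-minimal (wraparound) arc, whose total length is the ring size minus the minimal distance. -/
/-- Cyclic distance on the ring `ZMod k`. -/
def cycDist {k : ℕ} (a b : ZMod k) : ℕ := min (a - b).val (b - a).val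

theorem cycDist_of_sub_eq_natCast {k n : ℕ} [NeZero k] {a b : ZMod k} (hn : 2 * n ≤ k)
    (h : a - b = n) : cycDist a b = n := by
  have hk : 0 < k := NeZero.pos k
  have hval : (a - b).val = n := by
    rw [h, ZMod.val_natCast_of_lt (by omega)]
  unfold cycDist
  rw [← neg_sub a b, ZMod.neg_val, hval]
  split_ifs with h0
  · rw [h0, ZMod.val_zero] at hval
    omega
  · omega

/-- Routing through the Wraparound Intermediate Destination coordinate with
`β = 1` forces the packet around the non-minimal (wraparound) arc, whose total
length is the ring size minus the minimal distance. -/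
theorem widn_beta_one_wraparound (k : ℕ) (hk : 1 ≤ k) (s t : ZMod k)
    (Dst : ℕ) (hDst : Dst = (t - s).val)
    (h₀ : 0 < Dst) (h₁ : Dst ≤ k / 2)
    (m : ZMod k) (hm : m = s + (((Dst + k) / 2 : ℕ) : ZMod k)) :
    cycDist s m + cycDist m t = k - Dst := by
  have : NeZero k := ⟨by omega⟩
  have ht : (Dst : ZMod k) = t - s := by rw [hDst, ZMod.natCast_zmod_val]
  have hsm : cycDist s m = k - (Dst + k) / 2 := by
    apply cycDist_of_sub_eq_natCast (by omega)
    rw [Nat.cast_sub (by omega), ZMod.natCast_self, hm]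
    ring
  have hmt : cycDist m t = (Dst + k) / 2 - Dst := by
    apply cycDist_of_sub_eq_natCast (by omega)
    rw [Nat.cast_sub (by omega), ht, hm]
    ring
  rw [hsm, hmt]
  omega
end

section
/- Let n ≥ 1, k : Fin n → ℕ with k i ≥ 1, s, t ∈ Π i, ZMod (k i), and β : Fin n → Bool. For each i set Dst_i := (t i − s i).val and assume 0 < Dst_i ≤ ⌊(k i)/2⌋. Define the WIDN q(β) coordinatewise by q(β) i := s i + ⌊(Dst_i + (if β i then k i else 0))/2⌋. Then D(s, q(β)) + D(q(β), t) = Σ_i (if β i then k i − Dst_i else Dst_i). In words: routing through the wraparound intermediate destination q(β) yields a path whose length, in each dimension, equals the minimal arc length when β_i = 0 and the wraparound arc length k_i − d_i when β_i = 1, thus simulating the Pick-Orthant Routing behavior. -/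
/-- Torus distance on the `n`-dimensional torus. -/
def torusDist {n : ℕ} {k : Fin n → ℕ} (s t : ∀ i, ZMod (k i)) : ℕ :=
  ∑ i, cycDist (s i) (t i)

theorem cycDist_comm {k : ℕ} (a b : ZMod k) : cycDist a b = cycDist b a :=
  min_comm _ _

theorem cycDist_add_natCast {k : ℕ} (hk : 1 ≤ k) (a : ZMod k) {j : ℕ} (hj : 2 * j ≤ k) :
    cycDist a (a + j) = j := by
  have : NeZero k := ⟨by omega⟩
  have hval : (j : ZMod k).val = j := ZMod.val_cast_of_lt (by omega)
  rw [cycDist, sub_add_cancel_left, add_sub_cancel_left, ZMod.neg_val, hval]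
  split_ifs with h0
  · simp [h0] at hval
    omega
  · omega

theorem cycDist_midpoint {k : ℕ} (hk : 1 ≤ k) (s t q : ZMod k) (b : Bool)
    (hpos : 0 < (t - s).val) (hle : (t - s).val ≤ k / 2)
    (hq : q = s + ((((t - s).val + if b then k else 0) / 2 : ℕ) : ZMod k)) :
    cycDist s q + cycDist q t = if b then k - (t - s).val else (t - s).val := by
  have : NeZero k := ⟨by omega⟩
  have hcast : (((t - s).val : ℕ) : ZMod k) = t - s := ZMod.natCast_zmod_val _
  generalize (t - s).val = d at *
  obtain rfl : t = s + d := by rw [hcast]; ring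
  cases b
  · simp only [Bool.false_eq_true, if_false, add_zero] at hq ⊢
    have ht : s + (d : ZMod k) = q + ((d - d / 2 : ℕ) : ZMod k) := by
      rw [hq, add_assoc, ← Nat.cast_add, Nat.add_sub_cancel' (Nat.div_le_self d 2)]
    rw [ht, cycDist_add_natCast hk q (by omega), hq, cycDist_add_natCast hk s (by omega)]
    omega
  · simp only [if_true] at hq ⊢
    have hs : s = q + ((k - (d + k) / 2 : ℕ) : ZMod k) := by
      rw [hq, add_assoc, ← Nat.cast_add, Nat.add_sub_cancel' (by omega), ZMod.natCast_self,
        add_zero]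
    have hqt : q = s + d + (((d + k) / 2 - d : ℕ) : ZMod k) := by
      rw [hq, add_assoc, ← Nat.cast_add, Nat.add_sub_cancel' (by omega)]
    have h₁ : cycDist s q = k - (d + k) / 2 := by
      rw [cycDist_comm]
      conv_lhs => rw [hs]
      exact cycDist_add_natCast hk q (by omega)
    have h₂ : cycDist q (s + d) = (d + k) / 2 - d := by
      rw [cycDist_comm, hqt]
      exact cycDist_add_natCast hk (s + d) (by omega)
    omega

/-- Routing through the wraparound intermediate destination `q(β)` yields a path
whose length, in each dimension, equals the minimal arc length when `β i = false`
and the wraparound arc length `k i − Dst i` when `β i = true`, thus simulating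
the Pick-Orthant Routing behavior. -/
theorem widn_path_length (n : ℕ) (hn : 1 ≤ n) (k : Fin n → ℕ) (hk : ∀ i, 1 ≤ k i)
    (s t : ∀ i, ZMod (k i)) (β : Fin n → Bool)
    (h : ∀ i, 0 < (t i - s i).val ∧ (t i - s i).val ≤ k i / 2)
    (q : ∀ i, ZMod (k i))
    (hq : ∀ i, q i =
      s i + ((((t i - s i).val + if β i then k i else 0) / 2 : ℕ) : ZMod (k i))) :
    torusDist s q + torusDist q t =
      ∑ i, if β i then k i - (t i - s i).val else (t i - s i).val := by
  rw [torusDist, torusDist, ← Finset.sum_add_distrib]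
  exact Finset.sum_congr rfl fun i _ =>
    cycDist_midpoint (hk i) (s i) (t i) (q i) (β i) (h i).1 (h i).2 (hq i)
end

section
/- Let k₁, k₂ ≥ 1 and Δ ≥ 0 with 2Δ ≤ k₂ and Δ ≤ ⌊k₁/2⌋. Let s, t ∈ ZMod k₁ × ZMod k₂ be collinear with s₂ = t₂, set Dst := (t₁ − s₁).val, and assume 0 < Dst and Dst + Δ ≤ ⌊k₁/2⌋. Define the OIDN q := (s₁ − Δ, s₂ + Δ) (the outflank point behind the source in the μν dimension and displaced Δ in the νν dimension, i.e., λ = (−1, 1)). Then D(s, q) + D(q, t) = D(s, t) + 4Δ; i.e., this OIDN has exact additive dilation δ = 4Δ. -/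
/-- Torus distance on the two-dimensional torus. -/
def torusDist2 {k₁ k₂ : ℕ} (s t : ZMod k₁ × ZMod k₂) : ℕ :=
  cycDist s.1 t.1 + cycDist s.2 t.2

/-- Going forward by at most half of the cycle is a shortest path. -/
theorem cycDist_eq_of_sub_eq_natCast {k : ℕ} (hk : 1 ≤ k) {a b : ZMod k} {n : ℕ}
    (hn : 2 * n ≤ k) (h : b - a = n) : cycDist a b = n := by
  have : NeZero k := ⟨by omega⟩
  have hval : (b - a).val = n := by rw [h, ZMod.val_natCast_of_lt (by omega)]
  rw [cycDist, ← neg_sub b a, ZMod.neg_val, hval]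
  split_ifs with h0
  · rw [h0, ZMod.val_zero] at hval
    omega
  · omega

/-- For collinear `s` and `t`, the OIDN with `λ = (-1, 1)` (behind the source in
the μν dimension, displaced by `Δ` in the νν dimension) has exact additive
dilation `4Δ`. -/
theorem oidn_collinear_behind (k₁ k₂ : ℕ) (hk₁ : 1 ≤ k₁) (hk₂ : 1 ≤ k₂)
    (Δ : ℕ) (hΔ₂ : 2 * Δ ≤ k₂) (hΔ₁ : Δ ≤ k₁ / 2)
    (s t : ZMod k₁ × ZMod k₂) (hcol : s.2 = t.2)
    (Dst : ℕ) (hDst : Dst = (t.1 - s.1).val)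
    (h₀ : 0 < Dst) (h₁ : Dst + Δ ≤ k₁ / 2)
    (q : ZMod k₁ × ZMod k₂)
    (hq : q = (s.1 - (Δ : ZMod k₁), s.2 + (Δ : ZMod k₂))) :
    torusDist2 s q + torusDist2 q t = torusDist2 s t + 4 * Δ := by
  have : NeZero k₁ := ⟨by omega⟩
  have hst : t.1 - s.1 = (Dst : ZMod k₁) := by rw [hDst, ZMod.natCast_zmod_val]
  subst hq
  have hsq₁ : cycDist s.1 (s.1 - (Δ : ZMod k₁)) = Δ := by
    rw [cycDist_comm]
    exact cycDist_eq_of_sub_eq_natCast hk₁ (by omega) (by ring)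
  have hsq₂ : cycDist s.2 (s.2 + (Δ : ZMod k₂)) = Δ :=
    cycDist_eq_of_sub_eq_natCast hk₂ hΔ₂ (by ring)
  have hqt₁ : cycDist (s.1 - (Δ : ZMod k₁)) t.1 = Dst + Δ :=
    cycDist_eq_of_sub_eq_natCast hk₁ (by omega) (by
      push_cast
      rw [← hst]
      ring)
  have hst₁ : cycDist s.1 t.1 = Dst :=
    cycDist_eq_of_sub_eq_natCast hk₁ (by omega) hst
  have hst₂ : cycDist s.2 s.2 = 0 :=
    cycDist_eq_of_sub_eq_natCast hk₂ (by omega) (by simp)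
  simp only [torusDist2, ← hcol, cycDist_comm (s.2 + (Δ : ZMod k₂)) s.2,
    hsq₁, hsq₂, hqt₁, hst₁, hst₂]
  omega
end

section
/- Let n ≥ 1, k : Fin n → ℕ with k i ≥ 1, Δ ≥ 0, and s, t, q ∈ Π i, ZMod (k i). Suppose that for every dimension i at least one of the following holds: d_{k i}(s i, q i) ≤ Δ, or d_{k i}(q i, t i) ≤ Δ, or d_{k i}(s i, q i) + d_{k i}(q i, t i) = d_{k i}(s i, t i). Let f : ℕ → Π i, ZMod (k i) be a trajectory with f 0 = s that routes minimally first to q and then to t (for every j < D(s,q), D(f (j+1), q) = D(f j, q) − 1; and for every j ≥ D(s,q) with f j ≠ t, D(f (j+1), t) = D(f j, t) − 1). Then there exists J ≤ D(s, t) + 2nΔ with f J = t. In words: every packet derouted by OutFlank Routing through an admissible OIDN reaches its destination within D(s,t) + 2nΔ hops, i.e., within an additive constant of the minimal distance. -/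
theorem cycDist_eq_natAbs_valMinAbs {k : ℕ} [NeZero k] (a b : ZMod k) :
    cycDist a b = (a - b).valMinAbs.natAbs := by
  rw [cycDist, ZMod.valMinAbs_natAbs_eq_min, ← neg_sub a b, ZMod.neg_val]
  split_ifs with h <;> simp [h]

theorem cycDist_triangle {k : ℕ} [NeZero k] (a b c : ZMod k) :
    cycDist a c ≤ cycDist a b + cycDist b c := by
  simp only [cycDist_eq_natAbs_valMinAbs]
  rw [← sub_add_sub_cancel a b c]
  exact (ZMod.natAbs_valMinAbs_add_le _ _).trans (Int.natAbs_add_le _ _)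

theorem cycDist_eq_zero_iff {k : ℕ} [NeZero k] {a b : ZMod k} :
    cycDist a b = 0 ↔ a = b := by
  rw [cycDist_eq_natAbs_valMinAbs, Int.natAbs_eq_zero, ZMod.valMinAbs_eq_zero, sub_eq_zero]

theorem torusDist_eq_zero_iff {n : ℕ} {k : Fin n → ℕ} [∀ i, NeZero (k i)]
    {s t : ∀ i, ZMod (k i)} : torusDist s t = 0 ↔ s = t := by
  simp [torusDist, cycDist_eq_zero_iff, funext_iff]

/-- A detour through a point near the source, near the destination, or on a minimal arc costs
at most `2 * Δ` extra hops. -/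
theorem cycDist_add_cycDist_le {k : ℕ} [NeZero k] {Δ : ℕ} {s q t : ZMod k}
    (h : cycDist s q ≤ Δ ∨ cycDist q t ≤ Δ ∨ cycDist s q + cycDist q t = cycDist s t) :
    cycDist s q + cycDist q t ≤ cycDist s t + 2 * Δ := by
  have hqt := cycDist_triangle q s t
  have hsq := cycDist_triangle s t q
  rw [cycDist_comm q s] at hqt
  rw [cycDist_comm t q] at hsq
  omega

theorem torusDist_add_torusDist_le {n : ℕ} {k : Fin n → ℕ} [∀ i, NeZero (k i)] {Δ : ℕ}
    {s q t : ∀ i, ZMod (k i)}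
    (h : ∀ i, cycDist (s i) (q i) ≤ Δ ∨ cycDist (q i) (t i) ≤ Δ ∨
      cycDist (s i) (q i) + cycDist (q i) (t i) = cycDist (s i) (t i)) :
    torusDist s q + torusDist q t ≤ torusDist s t + 2 * n * Δ := by
  calc torusDist s q + torusDist q t
      = ∑ i, (cycDist (s i) (q i) + cycDist (q i) (t i)) := Finset.sum_add_distrib.symm
    _ ≤ ∑ i, (cycDist (s i) (t i) + 2 * Δ) :=
        Finset.sum_le_sum fun i _ => cycDist_add_cycDist_le (h i)
    _ = torusDist s t + 2 * n * Δ := by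
        simp only [Finset.sum_add_distrib, Finset.sum_const, Finset.card_univ, Fintype.card_fin,
          smul_eq_mul, torusDist]
        ring

/-- A potential that drops by one at each of the steps `a, …, a + m - 1` has dropped by `m`. -/
theorem eq_sub_of_forall_succ_eq_sub_one {g : ℕ → ℕ} {a m : ℕ}
    (h : ∀ j < m, g (a + j + 1) = g (a + j) - 1) : g (a + m) = g a - m := by
  induction m with
  | zero => simp
  | succ m ih =>
    rw [← add_assoc, h m m.lt_succ_self, ih fun j hj => h j (hj.trans m.lt_succ_self), Nat.sub_sub]

/-- Every packet derouted by OutFlank Routing through an admissible OIDN reaches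
its destination within `D(s,t) + 2nΔ` hops, i.e., within an additive constant of
the minimal distance. -/
theorem ofr_bounded_delivery (n : ℕ) (hn : 1 ≤ n) (k : Fin n → ℕ)
    (hk : ∀ i, 1 ≤ k i) (Δ : ℕ) (s t q : ∀ i, ZMod (k i))
    (hq : ∀ i, cycDist (s i) (q i) ≤ Δ ∨ cycDist (q i) (t i) ≤ Δ ∨
      cycDist (s i) (q i) + cycDist (q i) (t i) = cycDist (s i) (t i))
    (f : ℕ → ∀ i, ZMod (k i)) (hf0 : f 0 = s)
    (hphase1 : ∀ j < torusDist s q,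
      torusDist (f (j + 1)) q = torusDist (f j) q - 1)
    (hphase2 : ∀ j, torusDist s q ≤ j → f j ≠ t →
      torusDist (f (j + 1)) t = torusDist (f j) t - 1) :
    ∃ J ≤ torusDist s t + 2 * n * Δ, f J = t := by
  have (i : Fin n) : NeZero (k i) := ⟨Nat.one_le_iff_ne_zero.mp (hk i)⟩
  have hfq : f (torusDist s q) = q := by
    have h := eq_sub_of_forall_succ_eq_sub_one (g := fun j => torusDist (f j) q) (a := 0)
      (m := torusDist s q) (by simpa using hphase1)
    simpa [hf0, torusDist_eq_zero_iff] using h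
  have hle := torusDist_add_torusDist_le hq
  by_contra! hne
  refine hne (torusDist s q + torusDist q t) hle (torusDist_eq_zero_iff.mp ?_)
  have h := eq_sub_of_forall_succ_eq_sub_one (g := fun j => torusDist (f j) t)
    (a := torusDist s q) (m := torusDist q t)
    fun j hj => hphase2 _ (Nat.le_add_right _ _) (hne _ (by omega))
  simpa [hfq] using h
end

section
/- Let n ≥ 1 and k : Fin n → ℕ with k i ≥ 3 for all i, and let G be the n-dimensional toroidal grid graph on Π i, ZMod (k i): two nodes u, v are adjacent if and only if there exists a dimension i such that u j = v j for all j ≠ i and (u i − v i = 1 or v i − u i = 1). Then for all s, t ∈ Π i, ZMod (k i), the graph distance of G between s and t equals D(s, t) = Σ_i min((s i − t i).val, (t i − s i).val). -/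
lemma cycDist_eq_min_sub {k : ℕ} [NeZero k] (a b : ZMod k) :
    cycDist a b = min (a - b).val (k - (a - b).val) := by
  rw [cycDist, ← neg_sub a b, ZMod.neg_val]
  split_ifs with h
  · simp [h]
  · rfl

lemma ZMod.val_add_one_eq_ite {k : ℕ} (hk : 2 ≤ k) (a : ZMod k) :
    (a + 1).val = if a.val + 1 = k then 0 else a.val + 1 := by
  have : NeZero k := ⟨by omega⟩
  have : Fact (1 < k) := ⟨hk⟩
  have ha := a.val_lt
  rw [ZMod.val_add, ZMod.val_one]
  split_ifs with h
  · rw [h, Nat.mod_self]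
  · exact Nat.mod_eq_of_lt (by omega)

lemma cycDist_add_one_le {k : ℕ} (hk : 2 ≤ k) (a b : ZMod k) :
    cycDist (a + 1) b ≤ cycDist a b + 1 ∧ cycDist a b ≤ cycDist (a + 1) b + 1 := by
  have : NeZero k := ⟨by omega⟩
  have h := ZMod.val_add_one_eq_ite hk (a - b)
  have ha := (a - b).val_lt
  rw [cycDist_eq_min_sub, cycDist_eq_min_sub, add_sub_right_comm]
  split_ifs at h <;> omega

lemma exists_cycDist_add_one_eq {k : ℕ} (hk : 2 ≤ k) {a b : ZMod k} (hab : a ≠ b) :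
    ∃ c : ZMod k, (a - c = 1 ∨ c - a = 1) ∧ cycDist c b + 1 = cycDist a b := by
  have : NeZero k := ⟨by omega⟩
  have hpos : 0 < (a - b).val := ZMod.val_pos.mpr (sub_ne_zero.mpr hab)
  have ha := (a - b).val_lt
  have hc := (a - 1 - b).val_lt
  have hup := ZMod.val_add_one_eq_ite hk (a - b)
  have hdown := ZMod.val_add_one_eq_ite hk (a - 1 - b)
  rw [← add_sub_right_comm] at hup
  rw [show a - 1 - b + 1 = a - b by ring] at hdown
  by_cases h : 2 * (a - b).val ≤ k
  · refine ⟨a - 1, Or.inl (by ring), ?_⟩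
    rw [cycDist_eq_min_sub, cycDist_eq_min_sub]
    split_ifs at hdown <;> omega
  · refine ⟨a + 1, Or.inr (by ring), ?_⟩
    rw [cycDist_eq_min_sub, cycDist_eq_min_sub]
    split_ifs at hup <;> omega

lemma torusDist_self {n : ℕ} {k : Fin n → ℕ} (s : ∀ i, ZMod (k i)) : torusDist s s = 0 := by
  simp [torusDist, cycDist]

/-- Torus distances to `t` from two nodes that agree outside dimension `i` differ only by the
contribution of dimension `i`. -/
lemma torusDist_add_cycDist_comm {n : ℕ} {k : Fin n → ℕ} {u v : ∀ i, ZMod (k i)} {i : Fin n}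
    (huv : ∀ j ≠ i, u j = v j) (t : ∀ i, ZMod (k i)) :
    torusDist u t + cycDist (v i) (t i) = torusDist v t + cycDist (u i) (t i) := by
  have h : ∑ j ∈ Finset.univ.erase i, cycDist (u j) (t j) =
      ∑ j ∈ Finset.univ.erase i, cycDist (v j) (t j) :=
    Finset.sum_congr rfl fun j hj => by rw [huv j (Finset.ne_of_mem_erase hj)]
  have hu := Finset.add_sum_erase _ (fun j => cycDist (u j) (t j)) (Finset.mem_univ i)
  have hv := Finset.add_sum_erase _ (fun j => cycDist (v j) (t j)) (Finset.mem_univ i)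
  simp only [torusDist]
  omega

/-- In the `n`-dimensional toroidal grid graph (nodes adjacent iff they differ by
`±1` in exactly one coordinate), the graph distance between any two nodes equals
the torus distance, i.e. the sum of the coordinatewise cyclic distances. -/
theorem torus_graph_dist (n : ℕ) (hn : 1 ≤ n) (k : Fin n → ℕ) (hk : ∀ i, 3 ≤ k i)
    (G : SimpleGraph (∀ i, ZMod (k i)))
    (hG : ∀ u v : ∀ i, ZMod (k i), G.Adj u v ↔
      ∃ i : Fin n, (∀ j ≠ i, u j = v j) ∧ (u i - v i = 1 ∨ v i - u i = 1)) :
    ∀ s t : ∀ i, ZMod (k i),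
      G.dist s t = ∑ i, min ((s i - t i).val) ((t i - s i).val) := by
  intro s t
  change G.dist s t = torusDist s t
  have hk2 : ∀ i, 2 ≤ k i := fun i => (Nat.le_succ 2).trans (hk i)
  have lower : ∀ {u v : ∀ i, ZMod (k i)} (p : G.Walk u v), torusDist u v ≤ p.length := by
    intro u v p
    induction p with
    | nil => simp [torusDist_self]
    | @cons u v w h p ih =>
      obtain ⟨i, hoff, hi⟩ := (hG u v).mp h
      have hsum := torusDist_add_cycDist_comm hoff w
      have hstep : cycDist (u i) (w i) ≤ cycDist (v i) (w i) + 1 := by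
        rcases hi with hi | hi
        · rw [sub_eq_iff_eq_add'.mp hi]
          exact (cycDist_add_one_le (hk2 i) (v i) (w i)).1
        · rw [sub_eq_iff_eq_add'.mp hi]
          exact (cycDist_add_one_le (hk2 i) (u i) (w i)).2
      rw [SimpleGraph.Walk.length_cons]
      omega
  have upper : ∀ (d : ℕ) (u : ∀ i, ZMod (k i)), torusDist u t = d →
      ∃ p : G.Walk u t, p.length = d := by
    intro d
    induction d with
    | zero =>
      intro u hu
      have hut : u = t := by
        by_contra hne
        obtain ⟨i, hi⟩ := Function.ne_iff.mp hne
        obtain ⟨c, -, hc⟩ := exists_cycDist_add_one_eq (hk2 i) hi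
        have := Finset.sum_eq_zero_iff.mp hu i (Finset.mem_univ i)
        omega
      subst hut
      exact ⟨.nil, rfl⟩
    | succ d ih =>
      intro u hu
      have hne : u ≠ t := by
        rintro rfl
        rw [torusDist_self] at hu
        omega
      obtain ⟨i, hi⟩ := Function.ne_iff.mp hne
      obtain ⟨c, hadj, hc⟩ := exists_cycDist_add_one_eq (hk2 i) hi
      have hoff : ∀ j ≠ i, u j = Function.update u i c j := fun j hj => by
        rw [Function.update_of_ne hj]
      have hsum := torusDist_add_cycDist_comm hoff t
      rw [Function.update_self] at hsum
      obtain ⟨p, hp⟩ := ih (Function.update u i c) (by omega)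
      have h : G.Adj u (Function.update u i c) :=
        (hG _ _).mpr ⟨i, hoff, by rwa [Function.update_self]⟩
      exact ⟨.cons h p, by rw [SimpleGraph.Walk.length_cons, hp]⟩
  obtain ⟨p, hp⟩ := upper _ s rfl
  obtain ⟨q, hq⟩ := p.reachable.exists_walk_length_eq_dist
  exact le_antisymm (hp ▸ SimpleGraph.dist_le p) (hq ▸ lower q)
end
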